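/- arXiv:1702.04082 — 3 statements merged into one kernel-verified Lean document; each statement's English description precedes it below -/
import Mathlib

section
/- For every S' ⊆ {1,…,m}, the coverage centrality of {a} in G_{S'} over Z = {(b,u_j) : 1 ≤ j ≤ n} ∪ {(u_j,b) : 1 ≤ j ≤ n} equals 2·|⋃_{i∈S'} S_i|. In particular, adding edges from a to a subfamily S' of set-nodes covers exactly (both orientations of) the pairs (b,u_j) with u_j in the union of the chosen sets. -/
/-- The vertices of the set-cover reduction graph: special vertices `a`, `b`, `c`,
a vertex `setv i` for each subset `S_i` (`1 ≤ i ≤ m`), a vertex `elemv j` for each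
element `u_j` of the ground set (`1 ≤ j ≤ n`), and a copy vertex `copyv j = t_j`. -/
inductive RedVert (m n : ℕ) : Type
  | a : RedVert m n
  | b : RedVert m n
  | c : RedVert m n
  | setv : Fin m → RedVert m n
  | elemv : Fin n → RedVert m n
  | copyv : Fin n → RedVert m n
  deriving DecidableEq

/-- The base edges of the reduction graph: `s_i – u_j` whenever `u_j ∈ S_i`;
`s_i – s_{i'}` for `i ≠ i'`; `u_j – t_j`; `c – t_j`; `b – a`; and `b – c`. -/
def baseRel (m n : ℕ) (S : Fin m → Finset (Fin n)) :
    RedVert m n → RedVert m n → Prop := fun x y =>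
  (∃ i j, j ∈ S i ∧ x = RedVert.setv i ∧ y = RedVert.elemv j) ∨
  (∃ i i', i ≠ i' ∧ x = RedVert.setv i ∧ y = RedVert.setv i') ∨
  (∃ j, x = RedVert.elemv j ∧ y = RedVert.copyv j) ∨
  (∃ j, x = RedVert.c ∧ y = RedVert.copyv j) ∨
  (x = RedVert.b ∧ y = RedVert.a) ∨
  (x = RedVert.b ∧ y = RedVert.c)

/-- The reduction graph `G_{S'}`: the base graph together with the edges `a – s_i`
for every `i ∈ S'`. -/
def redGraph (m n : ℕ) (S : Fin m → Finset (Fin n)) (S' : Finset (Fin m)) :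
    SimpleGraph (RedVert m n) :=
  SimpleGraph.fromRel
    (fun x y => baseRel m n S x y ∨ (∃ i ∈ S', x = RedVert.a ∧ y = RedVert.setv i))

/-- `v` lies on a shortest path between `s` and `t` in an undirected graph `G`:
`v ≠ s`, `v ≠ t`, `s` and `t` are connected, and `dist s v + dist v t = dist s t`. -/
def liesOnSP {V : Type*} (G : SimpleGraph V) (v s t : V) : Prop :=
  v ≠ s ∧ v ≠ t ∧ G.Reachable s t ∧ G.dist s v + G.dist v t = G.dist s t

/-- Coverage centrality of a vertex set `X` over a set `Z` of pairs: the number of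
pairs `(s,t) ∈ Z` with `s, t ∉ X` such that some vertex of `X` lies on a shortest
path between `s` and `t`. -/
noncomputable def coverage {V : Type*} (G : SimpleGraph V) (X : Set V)
    (Z : Set (V × V)) : ℕ :=
  Set.ncard {p ∈ Z | p.1 ∉ X ∧ p.2 ∉ X ∧ ∃ v ∈ X, liesOnSP G v p.1 p.2}

theorem SimpleGraph.Walk.le_add_length_of_adj_le {V : Type*} {G : SimpleGraph V} {f : V → ℕ}
    (hf : ∀ x y, G.Adj x y → f y ≤ f x + 1) {x y : V} (p : G.Walk x y) :
    f y ≤ f x + p.length := by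
  induction p with
  | nil => simp
  | cons h p ih =>
    have := hf _ _ h
    rw [SimpleGraph.Walk.length_cons]
    omega

theorem liesOnSP_comm {V : Type*} {G : SimpleGraph V} {v s t : V} :
    liesOnSP G v s t ↔ liesOnSP G v t s := by
  unfold liesOnSP
  rw [G.dist_comm (u := s) (v := v), G.dist_comm (u := v) (v := t),
    G.dist_comm (u := s) (v := t), G.reachable_comm, add_comm]
  tauto

namespace RedVert

/-- The layer of a vertex in the breadth-first layering rooted at `b`, when every set node is
placed in the layer below the element nodes. -/
def layer {m n : ℕ} : RedVert m n → ℕ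
  | a => 1
  | b => 0
  | c => 1
  | setv _ => 2
  | elemv _ => 3
  | copyv _ => 2

end RedVert

section RedGraph

open RedVert

variable {m n : ℕ} {S : Fin m → Finset (Fin n)} {S' : Finset (Fin m)}

theorem redGraph_layer_le {x y : RedVert m n} (h : (redGraph m n S S').Adj x y) :
    y.layer ≤ x.layer + 1 := by
  cases x <;> cases y <;> simp_all [redGraph, baseRel, layer]

theorem redGraph_adj_b_a : (redGraph m n S S').Adj b a := by
  simp [redGraph, baseRel]

theorem redGraph_adj_b_c : (redGraph m n S S').Adj b c := by
  simp [redGraph, baseRel]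

theorem redGraph_adj_c_copyv (j : Fin n) : (redGraph m n S S').Adj c (copyv j) := by
  simp [redGraph, baseRel]

theorem redGraph_adj_copyv_elemv (j : Fin n) :
    (redGraph m n S S').Adj (copyv j) (elemv j) := by
  simp [redGraph, baseRel]

theorem redGraph_adj_a_setv {i : Fin m} : (redGraph m n S S').Adj a (setv i) ↔ i ∈ S' := by
  simp [redGraph, baseRel]

theorem redGraph_adj_setv_elemv {i : Fin m} {j : Fin n} :
    (redGraph m n S S').Adj (setv i) (elemv j) ↔ j ∈ S i := by
  simp [redGraph, baseRel]

theorem redGraph_reachable_b_elemv (j : Fin n) :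
    (redGraph m n S S').Reachable b (elemv j) :=
  redGraph_adj_b_c.reachable.trans
    ((redGraph_adj_c_copyv j).reachable.trans (redGraph_adj_copyv_elemv j).reachable)

theorem redGraph_dist_b_elemv (j : Fin n) : (redGraph m n S S').dist b (elemv j) = 3 := by
  apply le_antisymm
  · exact SimpleGraph.dist_le (.cons redGraph_adj_b_c
      (.cons (redGraph_adj_c_copyv j) (.cons (redGraph_adj_copyv_elemv j) .nil)))
  · obtain ⟨p, hp⟩ := (redGraph_reachable_b_elemv (S := S) (S' := S') j).exists_walk_length_eq_dist
    have := p.le_add_length_of_adj_le (f := layer) fun _ _ => redGraph_layer_le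
    simp only [layer] at this
    omega

theorem redGraph_dist_a_elemv_eq_two_iff {j : Fin n} :
    (redGraph m n S S').dist a (elemv j) = 2 ↔ j ∈ S'.biUnion S := by
  have hr : (redGraph m n S S').Reachable a (elemv j) :=
    redGraph_adj_b_a.symm.reachable.trans (redGraph_reachable_b_elemv j)
  obtain ⟨p, hp⟩ := hr.exists_walk_length_eq_dist
  rw [Finset.mem_biUnion]
  constructor
  · intro h
    rw [h] at hp
    obtain ⟨x, hax, hxu⟩ : ∃ x, (redGraph m n S S').Adj a x ∧
        (redGraph m n S S').Adj x (elemv j) := by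
      cases p with
      | cons h₁ p =>
        cases p with
        | nil => simp at hp
        | cons h₂ p =>
          cases p with
          | nil => exact ⟨_, h₁, h₂⟩
          | cons h₃ p => simp at hp
    cases x with
    | setv i => exact ⟨i, redGraph_adj_a_setv.1 hax, redGraph_adj_setv_elemv.1 hxu⟩
    | _ => simp [redGraph, baseRel] at hax hxu
  · rintro ⟨i, hi, hj⟩
    apply le_antisymm
    · exact SimpleGraph.dist_le (.cons (redGraph_adj_a_setv.2 hi)
        (.cons (redGraph_adj_setv_elemv.2 hj) .nil))
    · have := p.le_add_length_of_adj_le (f := layer) fun _ _ => redGraph_layer_le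
      simp only [layer] at this
      omega

theorem redGraph_liesOnSP_a_iff {j : Fin n} :
    liesOnSP (redGraph m n S S') a b (elemv j) ↔ j ∈ S'.biUnion S := by
  rw [← redGraph_dist_a_elemv_eq_two_iff, liesOnSP, redGraph_dist_b_elemv,
    SimpleGraph.dist_eq_one_iff_adj.2 redGraph_adj_b_a]
  simp only [ne_eq, reduceCtorEq, not_false_eq_true, redGraph_reachable_b_elemv, true_and]
  omega

end RedGraph

/-- Core identity of the L-reduction from Maximum Coverage: for every
`S' ⊆ {1,…,m}`, the coverage centrality of `{a}` in `G_{S'}` over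
`Z = {(b,u_j)} ∪ {(u_j,b)}` equals `2·|⋃_{i ∈ S'} S_i|`. -/
theorem coverage_eq_two_mul_union (m n : ℕ) (hm : 1 ≤ m) (hn : 1 ≤ n)
    (S : Fin m → Finset (Fin n)) (hS : ∀ i, (S i).Nonempty)
    (S' : Finset (Fin m)) :
    coverage (redGraph m n S S') {RedVert.a}
        ({p : RedVert m n × RedVert m n | ∃ j, p = (RedVert.b, RedVert.elemv j)} ∪
         {p : RedVert m n × RedVert m n | ∃ j, p = (RedVert.elemv j, RedVert.b)}) =
      2 * (S'.biUnion S).card := by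
  have hset : {p ∈ ({p : RedVert m n × RedVert m n | ∃ j, p = (RedVert.b, RedVert.elemv j)} ∪
      {p : RedVert m n × RedVert m n | ∃ j, p = (RedVert.elemv j, RedVert.b)}) |
      p.1 ∉ ({RedVert.a} : Set (RedVert m n)) ∧ p.2 ∉ ({RedVert.a} : Set (RedVert m n)) ∧
        ∃ v ∈ ({RedVert.a} : Set (RedVert m n)), liesOnSP (redGraph m n S S') v p.1 p.2} =
      (fun j => (RedVert.b, RedVert.elemv j)) '' (S'.biUnion S : Set (Fin n)) ∪
      (fun j => (RedVert.elemv j, RedVert.b)) '' (S'.biUnion S : Set (Fin n)) := by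
    ext p
    simp only [Set.mem_ofPred_eq, Set.mem_union, Set.mem_image, Set.mem_singleton_iff,
      exists_eq_left, SetLike.mem_coe]
    constructor
    · rintro ⟨⟨j, rfl⟩ | ⟨j, rfl⟩, -, -, h⟩
      · exact .inl ⟨j, redGraph_liesOnSP_a_iff.1 h, rfl⟩
      · exact .inr ⟨j, redGraph_liesOnSP_a_iff.1 (liesOnSP_comm.1 h), rfl⟩
    · rintro (⟨j, h, rfl⟩ | ⟨j, h, rfl⟩)
      · exact ⟨.inl ⟨j, rfl⟩, nofun, nofun, redGraph_liesOnSP_a_iff.2 h⟩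
      · exact ⟨.inr ⟨j, rfl⟩, nofun, nofun, liesOnSP_comm.1 (redGraph_liesOnSP_a_iff.2 h)⟩
  rw [coverage, hset, Set.ncard_union_eq, Set.ncard_image_of_injective,
    Set.ncard_image_of_injective, Set.ncard_coe_finset, two_mul]
  · intro i j h
    simpa using h
  · intro i j h
    simpa using h
  · rw [Set.disjoint_left]
    rintro _ ⟨i, -, rfl⟩ ⟨j, -, h⟩
    simp at h
end

section
/- Given a finite undirected graph G = (V,E), a target set X ⊆ V, a set Z of pairs of vertices outside X, and a candidate set Γ of non-edges of G each having exactly one endpoint in X, the restricted coverage objective f : Finset Γ → ℕ is monotone (f(A) ≤ f(B) whenever A ⊆ B ⊆ Γ) and submodular (f(A ∪ {e}) − f(A) ≥ f(B ∪ {e}) − f(B) for all A ⊆ B ⊆ Γ and e ∈ Γ \ B). -/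
/-- The restricted coverage objective (RCCO, constraints `S¹` and `S²`): `rcov G X Z Es`
is the number of pairs `(s,t) ∈ Z` with `s, t ∉ X` such that some vertex of `X` lies
on a shortest path between `s` and `t` either in `G` or in `G + {e}` (the graph `G`
with the single edge `e` added) for some `e ∈ Es`. -/
noncomputable def rcov {V : Type*} (G : SimpleGraph V) (X : Set V)
    (Z : Set (V × V)) (Es : Finset (Sym2 V)) : ℕ :=
  Set.ncard {p ∈ Z | p.1 ∉ X ∧ p.2 ∉ X ∧
    ((∃ v ∈ X, liesOnSP G v p.1 p.2) ∨
      ∃ e ∈ Es, ∃ v ∈ X, liesOnSP (G ⊔ SimpleGraph.fromEdgeSet {e}) v p.1 p.2)}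

/-- The pairs counted by `rcov G X Z Es`. -/
def coveredPairs {V : Type*} (G : SimpleGraph V) (X : Set V)
    (Z : Set (V × V)) (Es : Finset (Sym2 V)) : Set (V × V) :=
  {p ∈ Z | p.1 ∉ X ∧ p.2 ∉ X ∧
    ((∃ v ∈ X, liesOnSP G v p.1 p.2) ∨
      ∃ e ∈ Es, ∃ v ∈ X, liesOnSP (G ⊔ SimpleGraph.fromEdgeSet {e}) v p.1 p.2)}

theorem coveredPairs_mono {V : Type*} (G : SimpleGraph V) (X : Set V)
    (Z : Set (V × V)) {A B : Finset (Sym2 V)} (h : A ⊆ B) :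
    coveredPairs G X Z A ⊆ coveredPairs G X Z B := by
  rintro p ⟨hp, hs, ht, hcov⟩
  exact ⟨hp, hs, ht, hcov.imp_right fun ⟨e, he, hv⟩ => ⟨e, h he, hv⟩⟩

theorem coveredPairs_union {V : Type*} [DecidableEq V] (G : SimpleGraph V) (X : Set V)
    (Z : Set (V × V)) (A B : Finset (Sym2 V)) :
    coveredPairs G X Z (A ∪ B) = coveredPairs G X Z A ∪ coveredPairs G X Z B := by
  refine Set.Subset.antisymm ?_ (Set.union_subset
    (coveredPairs_mono G X Z Finset.subset_union_left)
    (coveredPairs_mono G X Z Finset.subset_union_right))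
  rintro p ⟨hp, hs, ht, hcov | ⟨e, he, hv⟩⟩
  · exact Or.inl ⟨hp, hs, ht, Or.inl hcov⟩
  · exact (Finset.mem_union.mp he).imp
      (fun he => ⟨hp, hs, ht, Or.inr ⟨e, he, hv⟩⟩)
      (fun he => ⟨hp, hs, ht, Or.inr ⟨e, he, hv⟩⟩)

theorem rcov_union {V : Type*} [Finite V] [DecidableEq V] (G : SimpleGraph V) (X : Set V)
    (Z : Set (V × V)) (A B : Finset (Sym2 V)) :
    rcov G X Z (A ∪ B) =
      (coveredPairs G X Z B \ coveredPairs G X Z A).ncard + rcov G X Z A := by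
  change (coveredPairs G X Z (A ∪ B)).ncard = _ + (coveredPairs G X Z A).ncard
  rw [Set.ncard_sdiff_add_ncard, coveredPairs_union, Set.union_comm]

/-- The restricted coverage objective is monotone and submodular on subsets of a
candidate set `Γ` of non-edges of `G`, each having exactly one endpoint in `X`. -/
theorem rcov_monotone_submodular {V : Type*} [Fintype V] [DecidableEq V]
    (G : SimpleGraph V) (X : Set V) (Z : Set (V × V))
    (hZ : ∀ p ∈ Z, p.1 ∉ X ∧ p.2 ∉ X)
    (Γ : Finset (Sym2 V))
    (hΓ : ∀ e ∈ Γ, e ∉ G.edgeSet ∧ ∃ u v : V, e = s(u, v) ∧ u ∈ X ∧ v ∉ X) :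
    (∀ A B : Finset (Sym2 V), A ⊆ B → B ⊆ Γ →
      rcov G X Z A ≤ rcov G X Z B) ∧
    (∀ A B : Finset (Sym2 V), A ⊆ B → B ⊆ Γ → ∀ e ∈ Γ, e ∉ B →
      (rcov G X Z (B ∪ {e}) : ℤ) - (rcov G X Z B : ℤ) ≤
        (rcov G X Z (A ∪ {e}) : ℤ) - (rcov G X Z A : ℤ)) := by
  refine ⟨fun A B hAB _ => Set.ncard_le_ncard (coveredPairs_mono G X Z hAB) (Set.toFinite _),
    fun A B hAB _ e _ _ => ?_⟩
  have h : (coveredPairs G X Z {e} \ coveredPairs G X Z B).ncard ≤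
      (coveredPairs G X Z {e} \ coveredPairs G X Z A).ncard :=
    Set.ncard_le_ncard (Set.sdiff_subset_sdiff_right (coveredPairs_mono G X Z hAB))
      (Set.toFinite _)
  rw [rcov_union, rcov_union]
  push_cast
  lia
end

section
/- The unrestricted directed coverage-centrality objective under setting S^4 is not submodular: there exist a finite directed graph G, a target set X, a candidate set Γ of directed non-edges of G each incident to X, sets S ⊆ T ⊆ Γ, and an edge e ∈ Γ \ T such that f(T ∪ {e}) − f(T) > f(S ∪ {e}) − f(S), where f(E_s) is the directed coverage centrality of X in G + E_s over all ordered pairs of vertices outside X. A witness is the edgeless directed graph on vertices {x, a, b} with X = {x}, S = ∅, T = {(a,x)}, e = (x,b): then f(T ∪ {e}) = 1 (x lies on the shortest directed path from a to b) while f(T) = f(S) = f(S ∪ {e}) = 0. -/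
/-- There is a directed walk of length `n` from `s` to `t` with respect to the
edge relation `r`. -/
def hasDirPathLen {V : Type*} (r : V → V → Prop) (s t : V) (n : ℕ) : Prop :=
  ∃ f : ℕ → V, f 0 = s ∧ f n = t ∧ ∀ i < n, r (f i) (f (i + 1))

/-- There is a directed path from `s` to `t`. -/
def dReach {V : Type*} (r : V → V → Prop) (s t : V) : Prop :=
  ∃ n, hasDirPathLen r s t n

/-- Directed shortest-path distance from `s` to `t`. -/
noncomputable def dDist {V : Type*} (r : V → V → Prop) (s t : V) : ℕ :=
  sInf {n | hasDirPathLen r s t n}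

/-- `v` lies on a shortest directed path from `s` to `t`: `v ≠ s`, `v ≠ t`, there is a
directed path from `s` to `t`, and `dist s v + dist v t = dist s t`. -/
def dLiesOnSP {V : Type*} (r : V → V → Prop) (v s t : V) : Prop :=
  v ≠ s ∧ v ≠ t ∧ dReach r s t ∧ dDist r s v + dDist r v t = dDist r s t

/-- The unrestricted directed coverage-centrality objective: `ducov E X Es` is the
directed coverage centrality of `X` in `G + Es` over all ordered pairs of vertices
outside `X`, where `G = (V, E)` and all directed edges of `Es` are added. -/
noncomputable def ducov {V : Type*} (E : Set (V × V)) (X : Set V)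
    (Es : Finset (V × V)) : ℕ :=
  Set.ncard {p : V × V | p.1 ∉ X ∧ p.2 ∉ X ∧
    ∃ v ∈ X, dLiesOnSP (fun x y => (x, y) ∈ E ∨ (x, y) ∈ Es) v p.1 p.2}

theorem hasDirPathLen.snoc {V : Type*} {r : V → V → Prop} {s u v : V} {n : ℕ}
    (h : hasDirPathLen r s u n) (huv : r u v) : hasDirPathLen r s v (n + 1) := by
  obtain ⟨f, hs, hu, hf⟩ := h
  refine ⟨fun i => if i ≤ n then f i else v, by simp [hs], by simp, fun i hi => ?_⟩
  rcases (Nat.lt_succ_iff.mp hi).lt_or_eq with h | rfl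
  · simpa [h.le, Nat.succ_le_of_lt h] using hf i h
  · simpa [hu] using huv

/-- `d` is the distance function of a strongly connected digraph: it vanishes on the diagonal,
grows by at most one along an edge, and every vertex `v ≠ s` has an in-neighbour that is one step
closer to `s`. -/
structure IsDirDist {V : Type*} (r : V → V → Prop) (d : V → V → ℕ) : Prop where
  self : ∀ s, d s s = 0
  le_succ : ∀ s u v, r u v → d s v ≤ d s u + 1
  exists_pred : ∀ s v, v ≠ s → ∃ u, r u v ∧ d s v = d s u + 1

namespace IsDirDist

variable {V : Type*} {r : V → V → Prop} {d : V → V → ℕ}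

theorem hasDirPathLen (hd : IsDirDist r d) (s t : V) : hasDirPathLen r s t (d s t) := by
  induction hn : d s t generalizing t with
  | zero =>
    by_cases hts : t = s
    · exact ⟨fun _ => s, rfl, hts.symm, by simp⟩
    · obtain ⟨u, -, hu⟩ := hd.exists_pred s t hts
      omega
  | succ n ih =>
    have hts : t ≠ s := by
      rintro rfl
      simp [hd.self] at hn
    obtain ⟨u, hut, hu⟩ := hd.exists_pred s t hts
    exact (ih u (by omega)).snoc hut

theorem le_of_hasDirPathLen (hd : IsDirDist r d) {s t : V} {n : ℕ}
    (h : _root_.hasDirPathLen r s t n) : d s t ≤ n := by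
  obtain ⟨f, hs, ht, hf⟩ := h
  have key : ∀ i ≤ n, d s (f i) ≤ i := by
    intro i
    induction i with
    | zero => simp [hs, hd.self]
    | succ i ih =>
      intro hi
      have h₁ := hd.le_succ s _ _ (hf i hi)
      have h₂ := ih (by omega)
      omega
  simpa [ht] using key n le_rfl

theorem dDist_eq (hd : IsDirDist r d) (s t : V) : dDist r s t = d s t :=
  le_antisymm (Nat.sInf_le (hd.hasDirPathLen s t))
    (le_csInf ⟨_, hd.hasDirPathLen s t⟩ fun _ => hd.le_of_hasDirPathLen)

theorem dLiesOnSP_iff (hd : IsDirDist r d) (v s t : V) :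
    dLiesOnSP r v s t ↔ v ≠ s ∧ v ≠ t ∧ d s v + d v t = d s t := by
  have hst : dReach r s t := ⟨_, hd.hasDirPathLen s t⟩
  simp [dLiesOnSP, hd.dDist_eq, hst]

end IsDirDist

theorem ducov_singleton_eq_card {V : Type*} [Fintype V] [DecidableEq V] {E : Set (V × V)}
    {Es : Finset (V × V)} {d : V → V → ℕ}
    (hd : IsDirDist (fun x y => (x, y) ∈ E ∨ (x, y) ∈ Es) d) (x : V) :
    ducov E {x} Es = (Finset.univ.filter fun p : V × V =>
      x ≠ p.1 ∧ x ≠ p.2 ∧ d p.1 x + d x p.2 = d p.1 p.2).card := by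
  rw [ducov, ← Set.ncard_coe_finset]
  congr 1
  ext p
  simp only [hd.dLiesOnSP_iff, Set.mem_singleton_iff, exists_eq_left, Set.mem_ofPred_eq,
    Finset.coe_filter, Finset.mem_univ, true_and]
  constructor
  · exact fun h => h.2.2
  · exact fun h => ⟨h.1.symm, h.2.1.symm, h⟩

/-- The edges of the directed 4-cycle `0 → 1 → 2 → 3 → 0`. -/
def dirCycleFour : Finset (Fin 4 × Fin 4) := {(0, 1), (1, 2), (2, 3), (3, 0)}

theorem isDirDist_dirCycleFour {Es : Finset (Fin 4 × Fin 4)} {d : Fin 4 → Fin 4 → ℕ}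
    (self : ∀ s, d s s = 0)
    (le_succ : ∀ s u v, (u, v) ∈ dirCycleFour ∪ Es → d s v ≤ d s u + 1)
    (exists_pred : ∀ s v, v ≠ s → ∃ u, (u, v) ∈ dirCycleFour ∪ Es ∧ d s v = d s u + 1) :
    IsDirDist (fun x y => (x, y) ∈ (dirCycleFour : Set (Fin 4 × Fin 4)) ∨ (x, y) ∈ Es) d := by
  simp only [Finset.mem_union] at le_succ exists_pred
  exact ⟨self, le_succ, exists_pred⟩

theorem ducov_dirCycleFour : ducov (dirCycleFour : Set (Fin 4 × Fin 4)) {0} ∅ = 3 :=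
  (ducov_singleton_eq_card (isDirDist_dirCycleFour
    (d := ![![0, 1, 2, 3], ![3, 0, 1, 2], ![2, 3, 0, 1], ![1, 2, 3, 0]])
    (by decide) (by decide) (by decide)) 0).trans (by decide)

theorem ducov_dirCycleFour_out : ducov (dirCycleFour : Set (Fin 4 × Fin 4)) {0} {(0, 3)} = 3 :=
  (ducov_singleton_eq_card (isDirDist_dirCycleFour
    (d := ![![0, 1, 2, 1], ![3, 0, 1, 2], ![2, 3, 0, 1], ![1, 2, 3, 0]])
    (by decide) (by decide) (by decide)) 0).trans (by decide)

theorem ducov_dirCycleFour_in : ducov (dirCycleFour : Set (Fin 4 × Fin 4)) {0} (∅ ∪ {(1, 0)}) = 3 :=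
  (ducov_singleton_eq_card (isDirDist_dirCycleFour
    (d := ![![0, 1, 2, 3], ![1, 0, 1, 2], ![2, 3, 0, 1], ![1, 2, 3, 0]])
    (by decide) (by decide) (by decide)) 0).trans (by decide)

theorem ducov_dirCycleFour_out_in : ducov (dirCycleFour : Set (Fin 4 × Fin 4)) {0} ({(0, 3)} ∪ {(1, 0)}) = 4 :=
  (ducov_singleton_eq_card (isDirDist_dirCycleFour
    (d := ![![0, 1, 2, 1], ![1, 0, 1, 2], ![2, 3, 0, 1], ![1, 2, 3, 0]])
    (by decide) (by decide) (by decide)) 0).trans (by decide)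

/-- Under setting `S⁴` the unrestricted directed coverage-centrality objective is not
submodular: there exist a finite directed graph `G = (V, E)`, a target set `X`, a
candidate set `Γ` of directed non-edges of `G` each incident to `X`, sets
`S ⊆ T ⊆ Γ`, and an edge `e ∈ Γ \ T` such that
`f(T ∪ {e}) − f(T) > f(S ∪ {e}) − f(S)`. -/
theorem ducov_not_submodular :
    ∃ (V : Type) (_ : Fintype V) (_ : DecidableEq V) (E : Set (V × V))
      (X : Set V) (Γ S T : Finset (V × V)) (e : V × V),
      (∀ e' ∈ Γ, e' ∉ E ∧ (e'.1 ∈ X ∨ e'.2 ∈ X)) ∧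
      S ⊆ T ∧ T ⊆ Γ ∧ e ∈ Γ ∧ e ∉ T ∧
      (ducov E X (T ∪ {e}) : ℤ) - (ducov E X T : ℤ) >
        (ducov E X (S ∪ {e}) : ℤ) - (ducov E X S : ℤ) := by
  refine ⟨Fin 4, inferInstance, inferInstance, dirCycleFour, {0}, {(0, 3), (1, 0)}, ∅, {(0, 3)},
    (1, 0), ?_, by simp, by decide, by decide, by decide, ?_⟩
  · simp [dirCycleFour]
  · rw [ducov_dirCycleFour, ducov_dirCycleFour_out, ducov_dirCycleFour_in,
      ducov_dirCycleFour_out_in]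
    norm_num
end
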